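/- arXiv:2207.07554 — 5 statements merged into one kernel-verified Lean document; each statement's English description precedes it below -/
import Mathlib

section
/- Let A be an N×N real matrix with nonnegative entries, let v ∈ ℝ^N be a vector with all entries strictly positive, and let λ > 0 satisfy A·v = λ·v. Suppose there exist an integer p ≥ 1 and a constant K ≥ 1 such that every entry of A^p is strictly positive and (A^p)_{i,j} ≤ K·(A^p)_{k,l} for all indices i, j, k, l. Then v_i ≤ K·v_j for all indices i, j. -/
open Matrix

theorem Matrix.pow_mulVec_of_mulVec_eq_smul {n R : Type*} [Fintype n] [DecidableEq n]
    [CommSemiring R] {A : Matrix n n R} {v : n → R} {c : R} (h : A *ᵥ v = c • v) (p : ℕ) :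
    (A ^ p) *ᵥ v = c ^ p • v := by
  induction p with
  | zero => simp
  | succ p ih => rw [pow_succ, ← mulVec_mulVec, h, mulVec_smul, ih, smul_smul, pow_succ']

/-- If a nonnegative matrix `A` has a positive eigenvector `v` with positive eigenvalue, and
some power `A^p` has strictly positive entries whose pairwise ratios are bounded by `K`, then
the pairwise ratios of the entries of `v` are also bounded by `K`. -/
theorem eigenvector_ratio_bound {N : ℕ} (A : Matrix (Fin N) (Fin N) ℝ)
    (hA : ∀ i j, 0 ≤ A i j)
    (v : Fin N → ℝ) (hv : ∀ i, 0 < v i)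
    (lam : ℝ) (hlam : 0 < lam) (heig : A.mulVec v = lam • v)
    (p : ℕ) (hp : 1 ≤ p) (K : ℝ) (hK : 1 ≤ K)
    (hpos : ∀ i j, 0 < (A ^ p) i j)
    (hcomp : ∀ i j k l, (A ^ p) i j ≤ K * (A ^ p) k l) :
    ∀ i j, v i ≤ K * v j := by
  intro i j
  have hpow (k : Fin N) : ∑ l, (A ^ p) k l * v l = lam ^ p * v k :=
    congrFun (pow_mulVec_of_mulVec_eq_smul heig p) k
  refine le_of_mul_le_mul_left ?_ (pow_pos hlam p)
  calc lam ^ p * v i = ∑ l, (A ^ p) i l * v l := (hpow i).symm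
    _ ≤ ∑ l, K * (A ^ p) j l * v l :=
      Finset.sum_le_sum fun l _ => mul_le_mul_of_nonneg_right (hcomp i l j l) (hv l).le
    _ = K * ∑ l, (A ^ p) j l * v l := by simp only [Finset.mul_sum, mul_assoc]
    _ = lam ^ p * (K * v j) := by rw [hpow j, mul_left_comm]
end

section
/- Let A and B be N×N real matrices with nonnegative entries, let v ∈ ℝ^N have all entries strictly positive, and let λ ≥ 0 satisfy A·v = λ·v. Suppose there are δ ≥ 0 and a natural number s such that |B_{i,j} − A_{i,j}| ≤ δ for all i, j, and each row of B − A has at most s nonzero entries. Then the spectral radius of B is at least λ − δ·s·max_{i,j} (v_i/v_j). -/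
open Matrix

open Filter Topology

/-- A nonnegative matrix `B` with `r • v ≤ B *ᵥ v` for some `v ≥ 0` satisfies
`r ^ n • v ≤ B ^ n *ᵥ v`. -/
theorem pow_mul_le_pow_mulVec {ι : Type*} [Fintype ι] [DecidableEq ι] {B : Matrix ι ι ℝ}
    (hB : ∀ i j, 0 ≤ B i j) {v : ι → ℝ} {r : ℝ} (hr : 0 ≤ r)
    (h : ∀ i, r * v i ≤ (B *ᵥ v) i) (n : ℕ) (i : ι) :
    r ^ n * v i ≤ ((B ^ n) *ᵥ v) i := by
  induction n generalizing i with
  | zero => simp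
  | succ n ih =>
    rw [pow_succ' B, ← Matrix.mulVec_mulVec]
    calc r ^ (n + 1) * v i = r ^ n * (r * v i) := by ring
      _ ≤ r ^ n * (B *ᵥ v) i := by gcongr; exact h i
      _ = ∑ j, B i j * (r ^ n * v j) := by
        simp only [Matrix.mulVec, dotProduct, Finset.mul_sum]
        exact Finset.sum_congr rfl fun j _ => by ring
      _ ≤ ∑ j, B i j * ((B ^ n) *ᵥ v) j :=
        Finset.sum_le_sum fun j _ => mul_le_mul_of_nonneg_left (ih j) (hB i j)
      _ = (B *ᵥ ((B ^ n) *ᵥ v)) i := rfl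

section Norm

attribute [local instance] Matrix.linftyOpNormedRing Matrix.linftyOpNormedAlgebra

/-- Collatz–Wielandt lower bound: a nonnegative matrix `B` with `r • v ≤ B *ᵥ v` for some
positive vector `v` has spectral radius at least `r`. -/
theorem ofReal_le_spectralRadius_of_mul_le_mulVec {ι : Type*} [Fintype ι] [DecidableEq ι]
    [Nonempty ι] {B : Matrix ι ι ℝ} (hB : ∀ i j, 0 ≤ B i j) {v : ι → ℝ} (hv : ∀ i, 0 < v i)
    {r : ℝ} (h : ∀ i, r * v i ≤ (B *ᵥ v) i) :
    ENNReal.ofReal r ≤ spectralRadius ℂ (B.map Complex.ofReal) := by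
  rcases le_or_gt r 0 with hr | hr
  · simp [ENNReal.ofReal_of_nonpos hr]
  have : CompleteSpace (Matrix ι ι ℂ) := FiniteDimensional.complete ℂ _
  refine ge_of_tendsto
    (spectrum.pow_nnnorm_pow_one_div_tendsto_nhds_spectralRadius (B.map Complex.ofReal)) ?_
  filter_upwards [eventually_gt_atTop 0] with n hn
  obtain ⟨k, hk⟩ := Finite.exists_max v
  have hpow : r ^ n ≤ ‖(B.map Complex.ofReal) ^ n‖ := by
    have hmap : ((B.map Complex.ofReal) ^ n) *ᵥ (fun i => (v i : ℂ)) =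
        fun i => (((B ^ n) *ᵥ v) i : ℂ) := by
      have hp : (B.map Complex.ofReal) ^ n = (B ^ n).map Complex.ofReal :=
        (map_pow Complex.ofRealHom.mapMatrix B n).symm
      rw [hp]
      ext i
      exact (RingHom.map_mulVec Complex.ofRealHom (B ^ n) v i).symm
    have hnorm : ‖fun i => (v i : ℂ)‖ ≤ v k :=
      (pi_norm_le_iff_of_nonneg (hv k).le).2 fun i => by
        simpa [abs_of_pos (hv i)] using hk i
    refine le_of_mul_le_mul_right ?_ (hv k)
    calc r ^ n * v k ≤ ((B ^ n) *ᵥ v) k := pow_mul_le_pow_mulVec hB hr.le h n k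
      _ ≤ ‖(((B ^ n) *ᵥ v) k : ℂ)‖ := by
        rw [Complex.norm_real]
        exact Real.le_norm_self _
      _ ≤ ‖fun i => (((B ^ n) *ᵥ v) i : ℂ)‖ :=
        norm_le_pi_norm (fun i => (((B ^ n) *ᵥ v) i : ℂ)) k
      _ ≤ ‖(B.map Complex.ofReal) ^ n‖ * ‖fun i => (v i : ℂ)‖ := by
        rw [← hmap]
        exact Matrix.linfty_opNorm_mulVec _ _
      _ ≤ ‖(B.map Complex.ofReal) ^ n‖ * v k := by gcongr
  rw [one_div, ENNReal.le_rpow_inv_iff (by positivity), ENNReal.rpow_natCast,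
    ← ENNReal.ofReal_pow hr.le]
  exact ENNReal.ofReal_le_of_le_toReal (by simpa using hpow)

end Norm

/-- A sum of products is bounded below through the size and number of the nonzero entries of
the first factor. -/
theorem neg_mul_le_sum_mul_of_card_le {ι : Type*} [Fintype ι] {d w : ι → ℝ} {δ c : ℝ} {s : ℕ}
    (hδ : 0 ≤ δ) (hc : 0 ≤ c) (hd : ∀ j, |d j| ≤ δ) (hw : ∀ j, |w j| ≤ c)
    (hs : (Finset.univ.filter fun j => d j ≠ 0).card ≤ s) :
    -(δ * s * c) ≤ ∑ j, d j * w j := by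
  rw [← Finset.sum_filter_of_ne (p := fun j => d j ≠ 0)
    fun j _ hj => left_ne_zero_of_mul hj]
  refine (abs_le.1 ?_).1
  calc |∑ j with d j ≠ 0, d j * w j| ≤ ∑ j with d j ≠ 0, |d j * w j| :=
        Finset.abs_sum_le_sum_abs _ _
    _ ≤ ∑ j with d j ≠ 0, δ * c := Finset.sum_le_sum fun j _ => by
        rw [abs_mul]
        exact mul_le_mul (hd j) (hw j) (abs_nonneg _) hδ
    _ = (Finset.univ.filter fun j => d j ≠ 0).card * (δ * c) := by simp
    _ ≤ s * (δ * c) := by gcongr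
    _ = δ * s * c := by ring

/-- Collatz–Wielandt-type perturbation bound: if the nonnegative matrix `A` has a positive
eigenvector `v` with eigenvalue `lam ≥ 0`, and `B` is a nonnegative matrix whose entries differ
from those of `A` by at most `δ`, with at most `s` nonzero entries of `B - A` in each row, then
the spectral radius of `B` is at least `lam - δ·s·max_{i,j} (v i / v j)`. -/
theorem spectral_radius_perturbation_lower_bound {N : ℕ} (hN : 0 < N)
    (A B : Matrix (Fin N) (Fin N) ℝ)
    (hA : ∀ i j, 0 ≤ A i j) (hB : ∀ i j, 0 ≤ B i j)
    (v : Fin N → ℝ) (hv : ∀ i, 0 < v i)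
    (lam : ℝ) (hlam : 0 ≤ lam) (heig : A.mulVec v = lam • v)
    (δ : ℝ) (hδ0 : 0 ≤ δ) (s : ℕ)
    (hδ : ∀ i j, |B i j - A i j| ≤ δ)
    (hs : ∀ i, (Finset.univ.filter fun j => B i j - A i j ≠ 0).card ≤ s) :
    ENNReal.ofReal (lam - δ * s * (⨆ i, ⨆ j, v i / v j)) ≤
      spectralRadius ℂ (B.map (Complex.ofReal)) := by
  have : Nonempty (Fin N) := ⟨⟨0, hN⟩⟩
  set M := ⨆ i, ⨆ j, v i / v j with hM
  have hle : ∀ i j, v j ≤ M * v i := fun i j => by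
    rw [← div_le_iff₀ (hv i)]
    exact (le_ciSup (f := fun i => v j / v i) (Set.finite_range _).bddAbove i).trans
      (le_ciSup (f := fun j => ⨆ i, v j / v i) (Set.finite_range _).bddAbove j)
  refine ofReal_le_spectralRadius_of_mul_le_mulVec hB hv fun i => ?_
  have hsum := neg_mul_le_sum_mul_of_card_le (w := v) (c := M * v i) hδ0
    ((hv i).le.trans (hle i i)) (hδ i) (fun j => by rw [abs_of_pos (hv j)]; exact hle i j) (hs i)
  have hAi : ∑ j, A i j * v j = lam * v i := congrFun heig i
  have hBi : (B *ᵥ v) i = ∑ j, A i j * v j + ∑ j, (B i j - A i j) * v j := by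
    rw [← Finset.sum_add_distrib, Matrix.mulVec, dotProduct]
    exact Finset.sum_congr rfl fun j _ => by ring
  rw [hBi, hAi]
  linarith
end

section
/- Let k ≥ 2 and M ≥ 1 be integers and let α_0, α_1, …, α_k be strictly positive reals with ∑_{i=0}^{k} α_i = 1 and α_0 + α_k ≤ 1/e (e the Euler number). For each word w = (i_1, …, i_M) ∈ {1, …, k}^M define q'(w) = (α_{i_1}·α_{i_2}⋯α_{i_M})/(1−α_0)^{M−1}, augmented by adding α_0 when w = (k, k, …, k); that is, q'((k,…,k)) = α_0 + α_k^M/(1−α_0)^{M−1} and q'(w) = (∏_{j=1}^M α_{i_j})/(1−α_0)^{M−1} otherwise. Then q' is a probability distribution on {1,…,k}^M and −(1/M)·∑_{w} q'(w)·log q'(w) ≥ [−(α_0+α_k)·log(α_0+α_k) − ∑_{i=1}^{k−1} α_i·log α_i] − H_b(α_0), where H_b(x) = −x·log x − (1−x)·log(1−x) is the binary entropy function. -/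
open Finset

/-- The binary entropy function (natural logarithm). -/
noncomputable def Hb (x : ℝ) : ℝ := -x * Real.log x - (1 - x) * Real.log (1 - x)

lemma sum_prod_mul_sum_pi {ι : Type*} [Fintype ι] (M : ℕ) (f g : ι → ℝ) :
    ∑ w : Fin M → ι, (∏ j, f (w j)) * ∑ j, g (w j) =
      M * (∑ i, f i) ^ (M - 1) * ∑ i, f i * g i := by
  classical
  have marginal (m : Fin M) : ∑ w : Fin M → ι, (∏ j, f (w j)) * g (w m) =
      (∑ i, f i) ^ (M - 1) * ∑ i, f i * g i := by
    let F : Fin M → ι → ℝ := fun j i => if j = m then f i * g i else f i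
    have hF (w : Fin M → ι) : (∏ j, f (w j)) * g (w m) = ∏ j, F j (w j) := by
      rw [← Finset.mul_prod_erase univ (fun j => f (w j)) (mem_univ m),
        ← Finset.mul_prod_erase univ (fun j => F j (w j)) (mem_univ m),
        Finset.prod_congr rfl (fun j hj => if_neg (ne_of_mem_erase hj) :
          ∀ j ∈ univ.erase m, F j (w j) = f (w j))]
      simp only [F, if_true]
      ring
    rw [Finset.sum_congr rfl fun w _ => hF w, ← Fintype.piFinset_univ, ← Finset.prod_univ_sum,
      ← Finset.mul_prod_erase univ _ (mem_univ m),
      Finset.prod_congr rfl (fun j hj => by simp [F, ne_of_mem_erase hj] :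
          ∀ j ∈ univ.erase m, ∑ i, F j i = ∑ i, f i)]
    simp [F, card_erase_of_mem, mul_comm]
  simp_rw [Finset.mul_sum]
  rw [Finset.sum_comm]
  simp_rw [marginal, Finset.mul_sum]
  simp [Finset.mul_sum, mul_assoc]

lemma mul_log_antitone_of_le_inv_exp {u v : ℝ} (hu : 0 < u) (huv : u ≤ v)
    (hv : v ≤ 1 / Real.exp 1) : v * Real.log v ≤ u * Real.log u := by
  have hv0 : 0 < v := hu.trans_le huv
  have h1 : Real.log v ≤ -1 := by
    rw [Real.log_le_iff_le_exp hv0, Real.exp_neg]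
    simpa using hv
  have h2 := Real.log_le_sub_one_of_pos (div_pos hv0 hu)
  rw [Real.log_div hv0.ne' hu.ne'] at h2
  have h3 := mul_le_mul_of_nonneg_left h2 hu.le
  have h4 : u * (v / u - 1) = v - u := by field_simp
  nlinarith [mul_le_mul_of_nonneg_left h1 (sub_nonneg.2 huv)]

lemma mul_log_superadditive {x y : ℝ} (hx : 0 < x) (hy : 0 < y) :
    x * Real.log x + y * Real.log y ≤ (x + y) * Real.log (x + y) := by
  have h1 := Real.log_le_log hx (by linarith : x ≤ x + y)
  have h2 := Real.log_le_log hy (by linarith : y ≤ x + y)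
  nlinarith [mul_le_mul_of_nonneg_left h1 hx.le, mul_le_mul_of_nonneg_left h2 hy.le]

lemma sum_normalized_prod_mul_log {k M : ℕ} (hM : 1 ≤ M) {a : Fin k → ℝ} (ha : ∀ i, 0 < a i)
    {b : ℝ} (hb : 0 < b) (hsum : ∑ i, a i = b) :
    ∑ w : Fin M → Fin k,
        (∏ j, a (w j)) / b ^ (M - 1) * Real.log ((∏ j, a (w j)) / b ^ (M - 1)) =
      M * ∑ i, a i * Real.log (a i) - (M - 1) * (b * Real.log b) := by
  have hterm (w : Fin M → Fin k) :
      (∏ j, a (w j)) / b ^ (M - 1) * Real.log ((∏ j, a (w j)) / b ^ (M - 1)) =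
        (∏ j, a (w j)) * (∑ j, Real.log (a (w j))) / b ^ (M - 1) -
          (∏ j, a (w j)) * ((M - 1) * Real.log b / b ^ (M - 1)) := by
    rw [Real.log_div (prod_pos fun j _ => ha (w j)).ne' (pow_pos hb _).ne',
      Real.log_prod fun j _ => (ha (w j)).ne', Real.log_pow, Nat.cast_sub hM]
    push_cast
    ring
  have hpow : b ^ M = b * b ^ (M - 1) := by rw [← pow_succ', Nat.sub_add_cancel hM]
  rw [Finset.sum_congr rfl fun w _ => hterm w, Finset.sum_sub_distrib, ← Finset.sum_div,
    sum_prod_mul_sum_pi M a fun i => Real.log (a i), ← Finset.sum_mul, ← Fintype.sum_pow,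
    hsum, hpow]
  field_simp

/-- The entropy inequality for `M`-fold independent cutting and stacking with a reserved column:
the distribution `q'` on words of length `M` (the product distribution on the non-reserved
columns, with the reserved mass `α₀` added to the all-`last` word) is a probability
distribution, and its normalized Shannon entropy drops by at most `H_b(α₀)` below the
normalized Shannon entropy of the original gadget. -/
theorem cutting_stacking_entropy_inequality (k M : ℕ) (hk : 2 ≤ k) (hM : 1 ≤ M)
    (α0 : ℝ) (hα0 : 0 < α0)
    (a : Fin k → ℝ) (ha : ∀ i, 0 < a i)
    (hsum : α0 + ∑ i, a i = 1)
    (last : Fin k) (hlast : (last : ℕ) = k - 1)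
    (hsmall : α0 + a last ≤ 1 / Real.exp 1) :
    (∀ w : Fin M → Fin k,
        0 < (∏ j, a (w j)) / (1 - α0) ^ (M - 1) + (if w = fun _ => last then α0 else 0)) ∧
    (∑ w : Fin M → Fin k,
        ((∏ j, a (w j)) / (1 - α0) ^ (M - 1) + (if w = fun _ => last then α0 else 0))) = 1 ∧
    -(1 / (M : ℝ)) * ∑ w : Fin M → Fin k,
        ((∏ j, a (w j)) / (1 - α0) ^ (M - 1) + (if w = fun _ => last then α0 else 0)) *
          Real.log ((∏ j, a (w j)) / (1 - α0) ^ (M - 1) +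
            (if w = fun _ => last then α0 else 0)) ≥
      (-((α0 + a last) * Real.log (α0 + a last)) -
          ∑ i ∈ univ.filter (· ≠ last), a i * Real.log (a i)) - Hb α0 := by
  have hprod (w : Fin M → Fin k) : 0 < ∏ j, a (w j) := prod_pos fun j _ => ha (w j)
  have hb : ∑ i, a i = 1 - α0 := by linarith
  have hlast_le : a last ≤ 1 - α0 :=
    hb ▸ single_le_sum (fun i _ => (ha i).le) (mem_univ last)
  have hb0 : 0 < 1 - α0 := (ha last).trans_le hlast_le
  have hpow : (1 - α0) ^ M = (1 - α0) * (1 - α0) ^ (M - 1) := by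
    rw [← pow_succ', Nat.sub_add_cancel hM]
  refine ⟨fun w => ?_, ?_, ?_⟩
  · have := div_pos (hprod w) (pow_pos hb0 (M - 1))
    split_ifs <;> linarith
  · rw [Finset.sum_add_distrib, ← Finset.sum_div, ← Fintype.sum_pow, hb, hpow,
      mul_div_cancel_right₀ _ (pow_pos hb0 _).ne']
    simp
  · set u : ℝ := a last ^ M / (1 - α0) ^ (M - 1) with hu
    have hu0 : 0 < u := div_pos (pow_pos (ha last) _) (pow_pos hb0 _)
    have hu_le : u ≤ a last := by
      rw [hu, div_le_iff₀ (pow_pos hb0 _)]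
      calc a last ^ M = a last * a last ^ (M - 1) := by
            rw [← pow_succ', Nat.sub_add_cancel hM]
        _ ≤ a last * (1 - α0) ^ (M - 1) :=
            mul_le_mul_of_nonneg_left (pow_le_pow_left₀ (ha last).le hlast_le _) (ha last).le
    have hterm (w : Fin M → Fin k) :
        ((∏ j, a (w j)) / (1 - α0) ^ (M - 1) + (if w = fun _ => last then α0 else 0)) *
          Real.log ((∏ j, a (w j)) / (1 - α0) ^ (M - 1) +
            (if w = fun _ => last then α0 else 0)) =
        (∏ j, a (w j)) / (1 - α0) ^ (M - 1) *
          Real.log ((∏ j, a (w j)) / (1 - α0) ^ (M - 1)) +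
        (if w = fun _ => last then (u + α0) * Real.log (u + α0) - u * Real.log u else 0) := by
      split_ifs with hw
      · subst hw
        simp [hu]
      · simp
    have hsplit : ∑ i, a i * Real.log (a i) =
        a last * Real.log (a last) + ∑ i ∈ univ.filter (· ≠ last), a i * Real.log (a i) := by
      rw [filter_ne', add_sum_erase univ (fun i => a i * Real.log (a i)) (mem_univ last)]
    have hmono : (u + α0) * Real.log (u + α0) ≤ u * Real.log u :=
      mul_log_antitone_of_le_inv_exp hu0 (by linarith) (by linarith)
    have hsuper := mul_log_superadditive hα0 (ha last)
    have hblog : (1 - α0) * Real.log (1 - α0) ≤ 0 :=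
      mul_nonpos_of_nonneg_of_nonpos hb0.le (Real.log_nonpos hb0.le (by linarith))
    have hM0 : (0 : ℝ) < M := by exact_mod_cast hM
    rw [Finset.sum_congr rfl fun w _ => hterm w, Finset.sum_add_distrib,
      sum_normalized_prod_mul_log hM ha hb0 hb, Finset.sum_ite_eq' univ, if_pos (mem_univ _),
      hsplit, Hb, ge_iff_le, neg_mul (1 / (M : ℝ)), one_div_mul_eq_div, le_neg, div_le_iff₀ hM0]
    nlinarith [mul_le_mul_of_nonneg_left hsuper hM0.le]
end

section
/- Let 𝒜 be a finite alphabet, N ≥ 1 an integer, and p a probability measure on 𝒜^N. Let ν := (1/N)·∑_{i=0}^{N−1} (T^i)_*(ψ_* p^{⊗ℕ}) be the distribution of the concatenated-block process defined by p, where ψ : (𝒜^N)^ℕ → 𝒜^ℕ is the concatenation map ψ(y)(jN + r) = y(j)(r) (0 ≤ r < N), p^{⊗ℕ} is the infinite product measure of p, and T is the left shift on 𝒜^ℕ. Then the Shannon entropy rate of ν equals the normalized entropy of p: lim_{n→∞} (1/n)·( −∑_{w∈𝒜^n} ν[w]·log ν[w] ) = (1/N)·( −∑_{u∈𝒜^N}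 p(u)·log p(u) ), where ν[w] denotes the ν-measure of the cylinder set of the word w and terms with zero probability are read as 0. -/
open MeasureTheory Filter Topology
open scoped ENNReal

/-- The left shift on one-sided sequences. -/
def shift {𝒜 : Type} (x : ℕ → 𝒜) : ℕ → 𝒜 := fun n => x (n + 1)

/-- The concatenation map `(𝒜^N)^ℕ → 𝒜^ℕ`, `ψ(y)(jN + r) = y(j)(r)` for `0 ≤ r < N`. -/
def concatMap {𝒜 : Type} (N : ℕ) (hN : 0 < N) (y : ℕ → (Fin N → 𝒜)) : ℕ → 𝒜 :=
  fun n => y (n / N) ⟨n % N, Nat.mod_lt n hN⟩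

/-- `P` is the infinite product measure of `p`: a probability measure under which the
coordinates are i.i.d. with law `p` (characterized by its values on cylinder sets). -/
def IsInfiniteProduct {β : Type} [MeasurableSpace β] (p : Measure β)
    (P : Measure (ℕ → β)) : Prop :=
  IsProbabilityMeasure P ∧
    ∀ (J : ℕ) (c : Fin J → β), P {y : ℕ → β | ∀ j : Fin J, y j.val = c j} = ∏ j, p {c j}

/-- The distribution of the concatenated-block process defined by blocks of law `P`:
the average over a random start of the pushforward of `P` under concatenation. -/
noncomputable def blockProcessMeasure {𝒜 : Type} [MeasurableSpace 𝒜] (N : ℕ) (hN : 0 < N)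
    (P : Measure (ℕ → (Fin N → 𝒜))) : Measure (ℕ → 𝒜) :=
  (N : ℝ≥0∞)⁻¹ • ∑ i ∈ Finset.range N,
    Measure.map (shift^[i]) (Measure.map (concatMap N hN) P)

/-- The measure of the cylinder set determined by a finite word `w`. -/
noncomputable def cylMeas {𝒜 : Type} [MeasurableSpace 𝒜] (μ : Measure (ℕ → 𝒜)) {n : ℕ}
    (w : Fin n → 𝒜) : ℝ :=
  (μ {x : ℕ → 𝒜 | ∀ i : Fin n, x i.val = w i}).toReal

open Real (negMulLog)

theorem negMulLog_sum_le {ι : Type*} (s : Finset ι) (q : ι → ℝ) (hq : ∀ i ∈ s, 0 ≤ q i) :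
    negMulLog (∑ i ∈ s, q i) ≤ ∑ i ∈ s, negMulLog (q i) := by
  rw [negMulLog, neg_mul, Finset.sum_mul, ← Finset.sum_neg_distrib]
  refine Finset.sum_le_sum fun i hi => ?_
  rw [negMulLog, neg_mul, neg_le_neg_iff]
  rcases (hq i hi).eq_or_lt with h | h
  · simp [← h]
  · exact mul_le_mul_of_nonneg_left
      (Real.log_le_log h (Finset.single_le_sum hq hi)) h.le

theorem sum_negMulLog_prod {β : Type*} [Fintype β] (q : β → ℝ) (hq : ∑ b, q b = 1) (m : ℕ) :
    ∑ c : Fin m → β, negMulLog (∏ j, q (c j)) = m * ∑ b, negMulLog (q b) := by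
  induction m with
  | zero => simp
  | succ m ih =>
    have hone : ∑ c : Fin m → β, ∏ j, q (c j) = 1 := by
      rw [← Fintype.sum_pow, hq, one_pow]
    rw [← (Fin.consEquiv fun _ => β).sum_comp, Fintype.sum_prod_type]
    simp only [Fin.consEquiv_apply, Fin.prod_univ_succ, Fin.cons_zero, Fin.cons_succ,
      Real.negMulLog_mul, Finset.sum_add_distrib, ← Finset.sum_mul, ← Finset.mul_sum]
    rw [hone, hq, ih]
    push_cast
    ring

/-- The Shannon entropy of a finitely valued random variable. -/
noncomputable def finEntropy {Ω β : Type*} [MeasurableSpace Ω] [Fintype β] (P : Measure Ω)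
    (X : Ω → β) : ℝ :=
  ∑ b, negMulLog (P.real {ω | X ω = b})

theorem sum_measureReal_fiber {Ω β : Type*} [MeasurableSpace Ω] (P : Measure Ω)
    [IsFiniteMeasure P] (X : Ω → β) (hX : ∀ b, MeasurableSet {ω | X ω = b}) (s : Finset β) :
    ∑ b ∈ s, P.real {ω | X ω = b} = P.real {ω | X ω ∈ s} := by
  rw [← measureReal_biUnion_finset]
  · congr 1
    ext ω
    simp
  · intro a _ b _ hab
    refine Set.disjoint_left.2 fun ω h1 h2 => hab ?_
    exact h1.symm.trans h2
  · exact fun b _ => hX b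

theorem finEntropy_comp_le {Ω β γ : Type*} [MeasurableSpace Ω] [Fintype β] [Fintype γ]
    (P : Measure Ω) [IsFiniteMeasure P] (X : Ω → β) (hX : ∀ b, MeasurableSet {ω | X ω = b})
    (g : β → γ) : finEntropy P (fun ω => g (X ω)) ≤ finEntropy P X := by
  classical
  unfold finEntropy
  rw [← Finset.sum_fiberwise Finset.univ g]
  refine Finset.sum_le_sum fun c _ => ?_
  refine le_trans (le_of_eq ?_) (negMulLog_sum_le _ _ fun b _ => measureReal_nonneg)
  rw [sum_measureReal_fiber P X hX]
  simp

theorem average_sum_negMulLog_le {ι κ : Type*} [Fintype κ] (s : Finset ι)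
    (hs : s.Nonempty) (q : ι → κ → ℝ) (hq : ∀ i w, 0 ≤ q i w) :
    (s.card : ℝ)⁻¹ * ∑ i ∈ s, ∑ w, negMulLog (q i w) ≤
      ∑ w, negMulLog ((s.card : ℝ)⁻¹ * ∑ i ∈ s, q i w) := by
  have hN : (0 : ℝ) < s.card := by exact_mod_cast hs.card_pos
  rw [Finset.sum_comm, Finset.mul_sum]
  refine Finset.sum_le_sum fun w _ => ?_
  have := Real.concaveOn_negMulLog.le_map_sum (t := s) (w := fun _ => (s.card : ℝ)⁻¹)
    (p := fun i => q i w) (fun _ _ => by positivity) (by simp [hN.ne']) (fun i _ => hq i w)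
  simpa only [smul_eq_mul, ← Finset.mul_sum] using this

theorem sum_negMulLog_average_le {ι κ : Type*} [Fintype κ] (s : Finset ι)
    (hs : s.Nonempty) (q : ι → κ → ℝ) (hq : ∀ i w, 0 ≤ q i w)
    (hq1 : ∀ i, ∑ w, q i w = 1) :
    ∑ w, negMulLog ((s.card : ℝ)⁻¹ * ∑ i ∈ s, q i w) ≤
      (s.card : ℝ)⁻¹ * ∑ i ∈ s, ∑ w, negMulLog (q i w) + Real.log s.card := by
  have hN : (0 : ℝ) < s.card := by exact_mod_cast hs.card_pos
  calc _ ≤ ∑ w, ∑ i ∈ s, negMulLog ((s.card : ℝ)⁻¹ * q i w) := by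
        refine Finset.sum_le_sum fun w _ => ?_
        rw [Finset.mul_sum]
        exact negMulLog_sum_le _ _ fun i _ => mul_nonneg (by positivity) (hq i w)
    _ = _ := by
        rw [Finset.sum_comm]
        simp only [Real.negMulLog_mul, Finset.sum_add_distrib, ← Finset.sum_mul, ← Finset.mul_sum,
          hq1]
        rw [negMulLog, Real.log_inv, Finset.sum_const, nsmul_eq_mul]
        field_simp
        ring

theorem measurableSet_pi_eq {γ ι : Type*} [Countable ι] [MeasurableSpace γ]
    [MeasurableSingletonClass γ] {Ω : Type*} [MeasurableSpace Ω] (X : Ω → ι → γ)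
    (hX : Measurable X) (c : ι → γ) : MeasurableSet {ω | X ω = c} :=
  hX (measurableSet_singleton c)

section InfiniteProduct

variable {β : Type} [Fintype β] [MeasurableSpace β] [MeasurableSingletonClass β]

theorem sum_measureReal_singleton_eq_one (p : Measure β) [IsProbabilityMeasure p] :
    ∑ b, p.real {b} = 1 := by
  simp

theorem IsInfiniteProduct.finEntropy_initial {p : Measure β} [IsProbabilityMeasure p]
    {P : Measure (ℕ → β)} (hP : IsInfiniteProduct p P) (m : ℕ) :
    finEntropy P (fun y (j : Fin m) => y j) = m * ∑ b, negMulLog (p.real {b}) := by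
  rw [← sum_negMulLog_prod _ (sum_measureReal_singleton_eq_one p)]
  refine Finset.sum_congr rfl fun c _ => ?_
  have := hP.2 m c
  simp only [measureReal_def, funext_iff, this, ENNReal.toReal_prod]

theorem IsInfiniteProduct.measureReal_tail {p : Measure β} [IsProbabilityMeasure p]
    {P : Measure (ℕ → β)} (hP : IsInfiniteProduct p P) (m : ℕ) (c : Fin m → β) :
    P.real {y | (fun j : Fin m => y (j + 1)) = c} = ∏ j, p.real {c j} := by
  classical
  have := hP.1
  have hsum := sum_measureReal_fiber P (fun y (j : Fin (m + 1)) => y j)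
    (measurableSet_pi_eq _ (by fun_prop)) (Finset.univ.image fun b : β => Fin.cons b c)
  rw [Finset.sum_image fun a _ b _ hab => (Fin.cons_injective2 hab).1] at hsum
  have hcons (b : β) : P.real {y | (fun j : Fin (m + 1) => y j) = (Fin.cons b c : Fin (m + 1) → β)}
      = p.real {b} * ∏ j, p.real {c j} := by
    have := hP.2 (m + 1) (Fin.cons b c)
    simp only [measureReal_def, funext_iff, this, Fin.prod_univ_succ, Fin.cons_zero,
      Fin.cons_succ, ENNReal.toReal_mul, ENNReal.toReal_prod]
  simp only [hcons, ← Finset.sum_mul, sum_measureReal_singleton_eq_one, one_mul] at hsum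
  rw [hsum]
  congr 1
  ext y
  simp [funext_iff, Fin.forall_fin_succ, eq_comm]

theorem IsInfiniteProduct.finEntropy_tail {p : Measure β} [IsProbabilityMeasure p]
    {P : Measure (ℕ → β)} (hP : IsInfiniteProduct p P) (m : ℕ) :
    finEntropy P (fun y (j : Fin m) => y (j + 1)) = m * ∑ b, negMulLog (p.real {b}) := by
  rw [← sum_negMulLog_prod _ (sum_measureReal_singleton_eq_one p)]
  exact Finset.sum_congr rfl fun c _ => by rw [hP.measureReal_tail]

end InfiniteProduct

theorem shift_iterate_apply {𝒜 : Type} (i : ℕ) (x : ℕ → 𝒜) (k : ℕ) :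
    shift^[i] x k = x (i + k) := by
  induction i generalizing x with
  | zero => simp
  | succ i ih => rw [Function.iterate_succ_apply, ih, shift]; congr 1; ring

theorem measurable_shift {𝒜 : Type} [MeasurableSpace 𝒜] :
    Measurable (shift : (ℕ → 𝒜) → ℕ → 𝒜) :=
  measurable_pi_lambda _ fun n => measurable_pi_apply (n + 1)

theorem measurable_concatMap {𝒜 : Type} [MeasurableSpace 𝒜] (N : ℕ) (hN : 0 < N) :
    Measurable (concatMap N hN : (ℕ → Fin N → 𝒜) → ℕ → 𝒜) := by
  unfold concatMap
  fun_prop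

/-- The word of length `n` read off the concatenated sequence from position `i`. -/
def blockWindow {𝒜 : Type} (N : ℕ) (hN : 0 < N) (i n : ℕ) (y : ℕ → Fin N → 𝒜) (k : Fin n) : 𝒜 :=
  concatMap N hN y (i + k)

section Window

variable {𝒜 : Type} [MeasurableSpace 𝒜] (N : ℕ) (hN : 0 < N)

theorem measurable_blockWindow (i n : ℕ) :
    Measurable (blockWindow N hN i n : (ℕ → Fin N → 𝒜) → Fin n → 𝒜) :=
  measurable_pi_lambda _ fun k =>
    (measurable_pi_apply (i + (k : ℕ))).comp (measurable_concatMap N hN)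

theorem cylMeas_blockProcessMeasure [MeasurableSingletonClass 𝒜]
    (P : Measure (ℕ → Fin N → 𝒜)) [IsFiniteMeasure P] {n : ℕ} (w : Fin n → 𝒜) :
    cylMeas (blockProcessMeasure N hN P) w =
      (N : ℝ)⁻¹ * ∑ i ∈ Finset.range N, P.real {y | blockWindow N hN i n y = w} := by
  have hmeas : MeasurableSet {x : ℕ → 𝒜 | ∀ i : Fin n, x i.val = w i} := by
    have h : Measurable fun (x : ℕ → 𝒜) (i : Fin n) => x i := by fun_prop
    simpa only [funext_iff] using measurableSet_pi_eq _ h w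
  simp only [cylMeas, blockProcessMeasure, Measure.smul_apply, Measure.finsetSum_apply,
    smul_eq_mul, ENNReal.toReal_mul, ENNReal.toReal_inv, ENNReal.toReal_natCast]
  have happ (i : ℕ) : Measure.map (shift^[i]) (Measure.map (concatMap N hN) P)
      {x : ℕ → 𝒜 | ∀ i : Fin n, x i.val = w i} = P {y | blockWindow N hN i n y = w} := by
    have hs : Measurable (shift^[i] : (ℕ → 𝒜) → ℕ → 𝒜) := measurable_shift.iterate i
    rw [Measure.map_apply hs hmeas,
      Measure.map_apply (measurable_concatMap N hN) (hs hmeas)]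
    congr 1
    ext y
    simp [shift_iterate_apply, blockWindow, funext_iff]
  simp only [happ]
  rw [ENNReal.toReal_sum fun i _ => measure_ne_top _ _]
  rfl

variable [Fintype 𝒜] [MeasurableSingletonClass 𝒜] {p : Measure (Fin N → 𝒜)}
  [IsProbabilityMeasure p] {P : Measure (ℕ → (Fin N → 𝒜))}

theorem finEntropy_blockWindow_le (hP : IsInfiniteProduct p P) {i : ℕ} (hi : i < N) (n : ℕ) :
    finEntropy P (blockWindow N hN i n) ≤ ((n / N + 2 : ℕ) : ℝ) * ∑ u, negMulLog (p.real {u}) := by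
  have := hP.1
  rw [← hP.finEntropy_initial]
  have hlt (k : Fin n) : (i + k) / N < n / N + 2 := by
    rw [Nat.div_lt_iff_lt_mul hN]
    have h1 := Nat.div_add_mod n N
    have h2 := Nat.mod_lt n hN
    have h3 := k.isLt
    nlinarith
  exact finEntropy_comp_le P (fun y (j : Fin (n / N + 2)) => y j)
    (measurableSet_pi_eq _ (by fun_prop))
    (fun c (k : Fin n) => c ⟨(i + k) / N, hlt k⟩ ⟨(i + k) % N, Nat.mod_lt _ hN⟩)

theorem le_finEntropy_blockWindow (hP : IsInfiniteProduct p P) {i : ℕ} (hi : i < N) (n : ℕ) :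
    ((n / N - 1 : ℕ) : ℝ) * ∑ u, negMulLog (p.real {u}) ≤ finEntropy P (blockWindow N hN i n) := by
  have := hP.1
  rw [← hP.finEntropy_tail]
  have hlt (j : Fin (n / N - 1)) (r : Fin N) : (j + 1) * N + r - i < n := by
    have h1 := Nat.div_mul_le_self n N
    have h2 : (j : ℕ) + 2 ≤ n / N := by have := j.isLt; omega
    have h3 := Nat.mul_le_mul_right N h2
    have h4 := r.isLt
    have h5 : ((j : ℕ) + 2) * N = (j + 1) * N + N := by ring
    omega
  convert finEntropy_comp_le P (blockWindow N hN i n)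
    (measurableSet_pi_eq _ (measurable_blockWindow N hN i n))
    (fun w (j : Fin (n / N - 1)) (r : Fin N) => w ⟨(j + 1) * N + r - i, hlt j r⟩) using 2
  ext y j r
  have h0 : i ≤ (j + 1) * N + r := by nlinarith [r.isLt, Nat.zero_le (j * N)]
  have hdiv : ((j + 1) * N + r) / N = j + 1 := by
    rw [add_comm, Nat.add_mul_div_right _ _ hN, Nat.div_eq_of_lt r.isLt, zero_add]
  have hmod : ((j + 1) * N + r) % N = r := by
    rw [add_comm, Nat.add_mul_mod_self_right, Nat.mod_eq_of_lt r.isLt]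
  simp only [blockWindow, concatMap, Nat.add_sub_cancel' h0, hdiv, hmod]

theorem abs_blockProcess_entropy_sub_le (hP : IsInfiniteProduct p P) (n : ℕ) :
    |∑ w : Fin n → 𝒜, negMulLog (cylMeas (blockProcessMeasure N hN P) w) -
        n * ((∑ u, negMulLog (p.real {u})) / N)| ≤
      2 * ∑ u, negMulLog (p.real {u}) + Real.log N := by
  have := hP.1
  set H := ∑ u, negMulLog (p.real {u}) with hH
  have hH0 : 0 ≤ H :=
    Finset.sum_nonneg fun u _ => Real.negMulLog_nonneg measureReal_nonneg measureReal_le_one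
  have hN' : (0 : ℝ) < N := by exact_mod_cast hN
  have hlog : 0 ≤ Real.log N := Real.log_natCast_nonneg N
  have hs : (Finset.range N).Nonempty := Finset.nonempty_range_iff.2 hN.ne'
  let q : ℕ → (Fin n → 𝒜) → ℝ := fun i w => P.real {y | blockWindow N hN i n y = w}
  have hq : ∀ i w, 0 ≤ q i w := fun i w => measureReal_nonneg
  have hq1 (i : ℕ) : ∑ w, q i w = 1 := by
    rw [sum_measureReal_fiber P _
      (measurableSet_pi_eq _ (measurable_blockWindow N hN i n))]
    simp
  have hlow := average_sum_negMulLog_le (Finset.range N) hs q hq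
  have hupp := sum_negMulLog_average_le (Finset.range N) hs q hq hq1
  rw [Finset.card_range] at hlow hupp
  simp only [cylMeas_blockProcessMeasure]
  have h1 : (N : ℝ)⁻¹ * ∑ i ∈ Finset.range N, ∑ w, negMulLog (q i w) ≤
      ((n / N + 2 : ℕ) : ℝ) * H := by
    rw [inv_mul_le_iff₀ hN']
    have := Finset.sum_le_card_nsmul (Finset.range N) (fun i => ∑ w, negMulLog (q i w)) _
      fun i hi => finEntropy_blockWindow_le N hN hP (Finset.mem_range.1 hi) n
    simpa using this
  have h2 : ((n / N - 1 : ℕ) : ℝ) * H ≤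
      (N : ℝ)⁻¹ * ∑ i ∈ Finset.range N, ∑ w, negMulLog (q i w) := by
    rw [le_inv_mul_iff₀ hN']
    have := Finset.card_nsmul_le_sum (Finset.range N) (fun i => ∑ w, negMulLog (q i w)) _
      fun i hi => le_finEntropy_blockWindow N hN hP (Finset.mem_range.1 hi) n
    simpa using this
  have h3 : ((n / N + 2 : ℕ) : ℝ) ≤ n / N + 2 := by
    push_cast
    gcongr
    exact Nat.cast_div_le
  have h4 : (n : ℝ) / N - 2 ≤ ((n / N - 1 : ℕ) : ℝ) := by
    have h5 : (n : ℝ) / N < (n / N : ℕ) + 1 := by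
      rw [div_lt_iff₀ hN']
      exact_mod_cast Nat.lt_mul_of_div_lt (Nat.lt_succ_self _) hN
    have h6 : ((n / N : ℕ) : ℝ) ≤ ((n / N - 1 : ℕ) : ℝ) + 1 := by
      exact_mod_cast le_tsub_add
    linarith
  have h7 := mul_le_mul_of_nonneg_right h3 hH0
  have h8 := mul_le_mul_of_nonneg_right h4 hH0
  have h9 : (n : ℝ) * (H / N) = n / N * H := by ring
  rw [abs_le, h9]
  constructor <;> linarith

end Window

/-- The Shannon entropy rate of the concatenated-block process defined by `p` equals the
normalized entropy of `p`. -/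
theorem concatenated_block_process_entropy_rate {𝒜 : Type} [Fintype 𝒜] [DecidableEq 𝒜]
    [MeasurableSpace 𝒜] [MeasurableSingletonClass 𝒜]
    (N : ℕ) (hN : 0 < N) (p : Measure (Fin N → 𝒜)) [IsProbabilityMeasure p]
    (P : Measure (ℕ → (Fin N → 𝒜))) (hP : IsInfiniteProduct p P) :
    Tendsto
      (fun n : ℕ =>
        (-∑ w : Fin n → 𝒜,
            cylMeas (blockProcessMeasure N hN P) w *
              Real.log (cylMeas (blockProcessMeasure N hN P) w)) / n)
      atTop
      (nhds ((-∑ u : Fin N → 𝒜, (p {u}).toReal * Real.log (p {u}).toReal) / N)) := by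
  simp only [← Finset.sum_neg_distrib, ← neg_mul]
  set H := ∑ u : Fin N → 𝒜, -(p {u}).toReal * Real.log (p {u}).toReal with hH
  have hbound := abs_blockProcess_entropy_sub_le N hN hP
  refine tendsto_iff_dist_tendsto_zero.2 <| squeeze_zero' (.of_forall fun _ => dist_nonneg) ?_
    (tendsto_const_div_atTop_nhds_zero_nat (2 * H + Real.log N))
  filter_upwards [eventually_gt_atTop 0] with n hn
  have hn' : (0 : ℝ) < n := by exact_mod_cast hn
  rw [Real.dist_eq, le_div_iff₀ hn', ← abs_of_pos hn', ← abs_mul, abs_of_pos hn', sub_mul,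
    div_mul_cancel₀ _ hn'.ne', mul_comm (H / N)]
  exact hbound n
end

section
/- Let μ be a shift-invariant Borel probability measure on {0,1}^ℕ and let (α_m)_{m≥1} be strictly positive reals with (1/m)·log α_m → 0 as m → ∞ and μ[1^m] ≥ α_m for every m ≥ 1, where 1^m is the all-ones word of length m. Then for every real α > 1, the α-th order Rényi entropy rate of μ exists and equals 0: (1/((1−α)·n))·log ∑_{w∈{0,1}^n} μ[w]^α → 0 as n → ∞. -/
open MeasureTheory Filter Topology

theorem cylMeas_nonneg {𝒜 : Type} [MeasurableSpace 𝒜] (μ : Measure (ℕ → 𝒜)) {n : ℕ}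
    (w : Fin n → 𝒜) : 0 ≤ cylMeas μ w :=
  ENNReal.toReal_nonneg

theorem sum_cylMeas {𝒜 : Type} [Fintype 𝒜] [MeasurableSpace 𝒜] [MeasurableSingletonClass 𝒜]
    (μ : Measure (ℕ → 𝒜)) [IsProbabilityMeasure μ] (n : ℕ) :
    ∑ w : Fin n → 𝒜, cylMeas μ w = 1 := by
  classical
  have hmeas : Measurable fun (x : ℕ → 𝒜) (i : Fin n) => x i.val := by fun_prop
  have hcyl (w : Fin n → 𝒜) :
      cylMeas μ w = μ.real ((fun (x : ℕ → 𝒜) (i : Fin n) => x i.val) ⁻¹' {w}) := by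
    simp only [cylMeas, measureReal_def]
    congr 2
    ext x
    simp [funext_iff]
  simp_rw [hcyl]
  rw [sum_measureReal_preimage_singleton _ fun w _ => hmeas (measurableSet_singleton w)]
  simp

theorem sum_cylMeas_rpow_le_one {𝒜 : Type} [Fintype 𝒜] [MeasurableSpace 𝒜]
    [MeasurableSingletonClass 𝒜] (μ : Measure (ℕ → 𝒜)) [IsProbabilityMeasure μ] (n : ℕ)
    {α : ℝ} (hα : 1 ≤ α) : ∑ w : Fin n → 𝒜, cylMeas μ w ^ α ≤ 1 := by
  rw [← sum_cylMeas μ n]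
  refine Finset.sum_le_sum fun w _ => ?_
  have hw : cylMeas μ w ≤ 1 := measureReal_le_one
  exact Real.rpow_le_self_of_le_one (cylMeas_nonneg μ w) hw hα

/-- If a stationary binary process gives the all-ones words subexponentially decaying
probability, then for every `α > 1` its `α`-th order Rényi entropy rate exists and is `0`. -/
theorem renyi_rate_zero_of_subexponential_ones
    (μ : Measure (ℕ → Bool)) [IsProbabilityMeasure μ]
    (hshift : MeasurePreserving (shift (𝒜 := Bool)) μ μ)
    (αseq : ℕ → ℝ)
    (hpos : ∀ m : ℕ, 1 ≤ m → 0 < αseq m)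
    (hsub : Tendsto (fun m : ℕ => Real.log (αseq m) / m) atTop (nhds 0))
    (hones : ∀ m : ℕ, 1 ≤ m → αseq m ≤ cylMeas μ (fun _ : Fin m => true)) :
    ∀ α : ℝ, 1 < α →
      Tendsto
        (fun n : ℕ =>
          (1 / ((1 - α) * n)) * Real.log (∑ w : Fin n → Bool, cylMeas μ w ^ α))
        atTop (nhds 0) := by
  intro α hα
  have hlim : Tendsto (fun n : ℕ => α / (1 - α) * (Real.log (αseq n) / n)) atTop (nhds 0) := by
    simpa using hsub.const_mul (α / (1 - α))
  have hcoef (n : ℕ) : 1 / ((1 - α) * n) ≤ 0 :=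
    one_div_nonpos.2 (mul_nonpos_of_nonpos_of_nonneg (by linarith) n.cast_nonneg)
  refine squeeze_zero' (Eventually.of_forall fun n => ?_) ?_ hlim
  · refine mul_nonneg_of_nonpos_of_nonpos (hcoef n) (Real.log_nonpos ?_ ?_)
    · exact Finset.sum_nonneg fun w _ => Real.rpow_nonneg (cylMeas_nonneg μ w) α
    · exact sum_cylMeas_rpow_le_one μ n hα.le
  · filter_upwards [eventually_ge_atTop 1] with n hn
    have hones_le : αseq n ^ α ≤ ∑ w : Fin n → Bool, cylMeas μ w ^ α :=
      (Real.rpow_le_rpow (hpos n hn).le (hones n hn) (by linarith)).trans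
        (Finset.single_le_sum (f := fun w : Fin n → Bool => cylMeas μ w ^ α)
          (fun w _ => Real.rpow_nonneg (cylMeas_nonneg μ w) α) (Finset.mem_univ _))
    have hlog := Real.log_le_log (Real.rpow_pos_of_pos (hpos n hn) α) hones_le
    rw [Real.log_rpow (hpos n hn)] at hlog
    calc 1 / ((1 - α) * n) * Real.log (∑ w : Fin n → Bool, cylMeas μ w ^ α)
        ≤ 1 / ((1 - α) * n) * (α * Real.log (αseq n)) :=
          mul_le_mul_of_nonpos_left hlog (hcoef n)
      _ = α / (1 - α) * (Real.log (αseq n) / n) := by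
          rw [one_div_mul_eq_div, div_mul_div_comm]
end
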